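/- arXiv:1308.6763 — 2 statements merged into one kernel-verified Lean document; each statement's English description precedes it below -/
import Mathlib

section
/- Let I be a finite index set, let x̄_i ∈ ℝ³ (i ∈ I) be fixed sampling positions, m > 0 a common particle mass, and u_i : ℝ → ℝ³ twice differentiable displacement trajectories obeying Newton's equations m ü_i(t) = Σ_{j≠i} f_ij(t), where the pairwise forces f_ij(t) ∈ ℝ³ satisfy f_ij(t) = −f_ji(t) for all t. Let φ : ℝ³ → ℝ be continuously differentiable, and define ρ̃(x) = Σ_{i∈I} m φ(x − x̄_i), ũ(x,t) = ρ̃(x)^{−1} Σ_{i∈I} m u_i(t) φ(x − x̄_i) (wherever ρ̃(x) ≠ 0), and the Hardy stress σ̃(x,t) = −(1/2) Σ_{i∈I} Σ_{j≠i} f_ij(t) (x̄_i − x̄_j)ᵀ b_ij(x) with b_ij(x) = ∫₀¹ φ(x − x̄_i + λ(x̄_i − x̄_j)) dλ. Then for every t and every x with ρ̃(x) ≠ 0, ρ̃(x) ∂²ũ/∂t²(x,t) = (∇·σ̃)(x,t). -/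
/-- Differentiation under the integral sign for the average of a `C¹` function along a segment. -/
theorem hasFDerivAt_integral_segment {E : Type*} [NormedAddCommGroup E] [NormedSpace ℝ E]
    [ProperSpace E] {φ : E → ℝ} (hφ : ContDiff ℝ 1 φ) (x v : E) :
    HasFDerivAt (fun y => ∫ l in (0:ℝ)..1, φ (y + l • v))
      (∫ l in (0:ℝ)..1, fderiv ℝ φ (x + l • v)) x := by
  have hφ' : Continuous (fderiv ℝ φ) := hφ.continuous_fderiv one_ne_zero
  have hφc : Continuous φ := hφ.continuous
  obtain ⟨C, hC⟩ := ((isCompact_closedBall x 1).prod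
    (isCompact_Icc (a := (0:ℝ)) (b := 1))).exists_bound_of_continuousOn
    (f := fun p : E × ℝ => fderiv ℝ φ (p.1 + p.2 • v)) (by fun_prop)
  refine (intervalIntegral.hasFDerivAt_integral_of_dominated_of_fderiv_le
    (F := fun y l => φ (y + l • v)) (F' := fun y l => fderiv ℝ φ (y + l • v))
    (bound := fun _ => C) (Metric.closedBall_mem_nhds x one_pos) ?_ ?_ ?_ ?_ ?_ ?_)
  · exact .of_forall fun y => Continuous.aestronglyMeasurable (by fun_prop)
  · exact Continuous.intervalIntegrable (by fun_prop) _ _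
  · exact Continuous.aestronglyMeasurable (by fun_prop)
  · refine .of_forall fun l hl y hy => hC (y, l) ⟨hy, ?_⟩
    rw [Set.uIoc_of_le zero_le_one] at hl
    exact Set.Ioc_subset_Icc_self hl
  · exact intervalIntegrable_const
  · exact .of_forall fun l _ y _ =>
      (hasFDerivAt_comp_add_right (l • v)).mpr
        (hφ.differentiable one_ne_zero (y + l • v)).hasFDerivAt

/-- The derivative of a segment average in the direction of the segment is the difference of the
endpoint values. -/
theorem integral_fderiv_segment_apply {E : Type*} [NormedAddCommGroup E] [NormedSpace ℝ E]
    {φ : E → ℝ} (hφ : ContDiff ℝ 1 φ) (x v : E) :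
    (∫ l in (0:ℝ)..1, fderiv ℝ φ (x + l • v)) v = φ (x + v) - φ x := by
  have hφ' : Continuous (fderiv ℝ φ) := hφ.continuous_fderiv one_ne_zero
  rw [ContinuousLinearMap.intervalIntegral_apply
    (Continuous.intervalIntegrable (by fun_prop) _ _)]
  have hderiv (l : ℝ) :
      HasDerivAt (fun l : ℝ => φ (x + l • v)) (fderiv ℝ φ (x + l • v) v) l := by
    refine (hφ.differentiable one_ne_zero (x + l • v)).hasFDerivAt.comp_hasDerivAt l ?_
    simpa using ((hasDerivAt_id l).smul_const v).const_add x
  rw [intervalIntegral.integral_eq_sub_of_hasDerivAt (fun l _ => hderiv l)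
    (Continuous.intervalIntegrable (by fun_prop) _ _)]
  simp

/-- Antisymmetrization of a sum of pairwise differences against antisymmetric weights. -/
theorem sum_antisymm_mul_sub {ι : Type*} [Fintype ι] [DecidableEq ι] (g : ι → ι → ℝ)
    (hg : ∀ i j, i ≠ j → g i j = -g j i) (p : ι → ℝ) :
    -(1 / 2 : ℝ) * ∑ i, ∑ j ∈ Finset.univ.filter (fun j => j ≠ i), g i j * (p j - p i)
      = ∑ i, p i * ∑ j ∈ Finset.univ.filter (fun j => j ≠ i), g i j := by
  have hswap : ∑ i, ∑ j ∈ Finset.univ.filter (fun j => j ≠ i), g i j * p j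
      = -∑ i, ∑ j ∈ Finset.univ.filter (fun j => j ≠ i), g i j * p i := by
    simp only [Finset.sum_filter]
    rw [Finset.sum_comm]
    simp only [← Finset.sum_neg_distrib]
    refine Finset.sum_congr rfl fun i _ => Finset.sum_congr rfl fun j _ => ?_
    by_cases h : i = j
    · simp [h]
    · simp [h, Ne.symm h, hg j i (Ne.symm h)]
  have hfactor : ∑ i, p i * ∑ j ∈ Finset.univ.filter (fun j => j ≠ i), g i j
      = ∑ i, ∑ j ∈ Finset.univ.filter (fun j => j ≠ i), g i j * p i := by
    simp only [mul_comm (p _), Finset.sum_mul]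
  simp only [mul_sub, Finset.sum_sub_distrib]
  rw [hswap, hfactor]
  ring

/-- Second derivative of a finite linear combination of `C²` curves. -/
theorem deriv_deriv_sum_smul {ι F : Type*} [Fintype ι] [NormedAddCommGroup F] [NormedSpace ℝ F]
    (c : ι → ℝ) {u : ι → ℝ → F} (hu : ∀ i, ContDiff ℝ 2 (u i)) (t : ℝ) :
    deriv (deriv fun s => ∑ i, c i • u i s) t = ∑ i, c i • deriv (deriv (u i)) t := by
  have hderiv : deriv (fun s => ∑ i, c i • u i s) = fun s => ∑ i, c i • deriv (u i) s :=
    funext fun s => (HasDerivAt.fun_sum fun i _ =>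
      ((hu i).differentiable two_ne_zero s).hasDerivAt.const_smul (c i)).deriv
  rw [hderiv]
  exact (HasDerivAt.fun_sum fun i _ =>
    (((hu i).differentiable_deriv_two) t).hasDerivAt.const_smul (c i)).deriv


/-- For particles of common mass `m > 0` at fixed sampling positions `x̄_i`
with twice differentiable displacement trajectories `u_i` obeying Newton's equations
`m ü_i = Σ_{j≠i} f_ij` (with antisymmetric pairwise forces) and a `C¹` kernel `φ`, the
local density `ρ̃`, local displacement `ũ`, and Hardy stress `σ̃` satisfy the
elastodynamics equation `ρ̃(x) ∂²ũ/∂t²(x,t) = (∇·σ̃)(x,t)` wherever `ρ̃(x) ≠ 0`. -/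
theorem hardy_elastodynamics
    {ι : Type*} [Fintype ι] [DecidableEq ι]
    (xb : ι → (Fin 3 → ℝ)) (m : ℝ) (hm : 0 < m)
    (u : ι → ℝ → (Fin 3 → ℝ)) (hu : ∀ i, ContDiff ℝ 2 (u i))
    (f : ι → ι → ℝ → (Fin 3 → ℝ))
    (hanti : ∀ i j (t : ℝ), i ≠ j → f i j t = - f j i t)
    (hnewton : ∀ i (t : ℝ), m • deriv (deriv (u i)) t
        = ∑ j ∈ Finset.univ.filter (fun j => j ≠ i), f i j t)
    (φ : (Fin 3 → ℝ) → ℝ) (hφ : ContDiff ℝ 1 φ)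
    (ρ : (Fin 3 → ℝ) → ℝ) (hρ : ∀ x : Fin 3 → ℝ, ρ x = ∑ i, m * φ (x - xb i))
    (ut : (Fin 3 → ℝ) → ℝ → (Fin 3 → ℝ))
    (hut : ∀ (x : Fin 3 → ℝ) (t : ℝ), ρ x ≠ 0 →
      ut x t = (ρ x)⁻¹ • ∑ i, (m * φ (x - xb i)) • u i t)
    (b : ι → ι → (Fin 3 → ℝ) → ℝ)
    (hb : ∀ i j (x' : Fin 3 → ℝ),
      b i j x' = ∫ l in (0:ℝ)..1, φ (x' - xb i + l • (xb i - xb j)))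
    (σ : (Fin 3 → ℝ) → ℝ → Matrix (Fin 3) (Fin 3) ℝ)
    (hσ : ∀ (x : Fin 3 → ℝ) (t : ℝ), σ x t = -(1/2 : ℝ) •
      ∑ i, ∑ j ∈ Finset.univ.filter (fun j => j ≠ i),
        b i j x • Matrix.vecMulVec (f i j t) (xb i - xb j)) :
    ∀ (t : ℝ) (x : Fin 3 → ℝ), ρ x ≠ 0 →
      ρ x • deriv (deriv (fun s => ut x s)) t
        = fun α => ∑ β, fderiv ℝ (fun y => σ y t α β) x (Pi.single β 1) := by
  intro t x hx
  have hb' (i j : ι) : HasFDerivAt (b i j)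
      (∫ l in (0:ℝ)..1, fderiv ℝ φ (x - xb i + l • (xb i - xb j))) x := by
    rw [funext (hb i j)]
    exact (hasFDerivAt_comp_sub (xb i)).mpr
      (hasFDerivAt_integral_segment hφ (x - xb i) (xb i - xb j))
  have hdir (i j : ι) : fderiv ℝ (b i j) x (xb i - xb j) = φ (x - xb j) - φ (x - xb i) := by
    rw [(hb' i j).fderiv, integral_fderiv_segment_apply hφ]
    simp
  have hσ' (α β : Fin 3) : fderiv ℝ (fun y => σ y t α β) x
      = -(1/2 : ℝ) • ∑ i, ∑ j ∈ Finset.univ.filter (fun j => j ≠ i),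
        (f i j t α * (xb i - xb j) β) • fderiv ℝ (b i j) x := by
    have hentry : (fun y => σ y t α β) = fun y => -(1/2 : ℝ) *
        ∑ i, ∑ j ∈ Finset.univ.filter (fun j => j ≠ i),
          (f i j t α * (xb i - xb j) β) * b i j y := by
      funext y
      simp only [hσ, Matrix.smul_apply, Matrix.sum_apply, Matrix.vecMulVec_apply, smul_eq_mul,
        mul_comm (b _ _ _)]
    rw [hentry]
    exact ((HasFDerivAt.fun_sum fun i _ => HasFDerivAt.fun_sum fun j _ =>
      (hb' i j).differentiableAt.hasFDerivAt.const_mul _).const_mul _).fderiv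
  have hut' : (fun s => ut x s) = fun s => ∑ i, ((ρ x)⁻¹ * (m * φ (x - xb i))) • u i s := by
    funext s
    rw [hut x s hx, Finset.smul_sum]
    simp only [smul_smul]
  have hlhs : ρ x • deriv (deriv fun s => ut x s) t
      = ∑ i, φ (x - xb i) • ∑ j ∈ Finset.univ.filter (fun j => j ≠ i), f i j t := by
    rw [hut', deriv_deriv_sum_smul _ hu, Finset.smul_sum]
    refine Finset.sum_congr rfl fun i _ => ?_
    rw [← hnewton, smul_smul, smul_smul]
    congr 1
    field_simp
  rw [hlhs]
  funext α
  have hcoord (L : (Fin 3 → ℝ) →L[ℝ] ℝ) (v : Fin 3 → ℝ) :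
      ∑ β, v β * L (Pi.single β 1) = L v := by
    conv_rhs => rw [pi_eq_sum_univ' v]
    simp [map_sum]
  have hanti' (i j : ι) (h : i ≠ j) : f i j t α = -f j i t α := by
    rw [hanti i j t h, Pi.neg_apply]
  calc (∑ i, φ (x - xb i) • ∑ j ∈ Finset.univ.filter (fun j => j ≠ i), f i j t) α
      = ∑ i, φ (x - xb i) * ∑ j ∈ Finset.univ.filter (fun j => j ≠ i), f i j t α := by
        simp only [Finset.sum_apply, Pi.smul_apply, smul_eq_mul]
    _ = -(1 / 2 : ℝ) * ∑ i, ∑ j ∈ Finset.univ.filter (fun j => j ≠ i),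
          f i j t α * (φ (x - xb j) - φ (x - xb i)) :=
        (sum_antisymm_mul_sub (fun i j => f i j t α) hanti' fun i => φ (x - xb i)).symm
    _ = ∑ β, fderiv ℝ (fun y => σ y t α β) x (Pi.single β 1) := by
        simp only [hσ', smul_apply, sum_apply, smul_eq_mul]
        rw [← Finset.mul_sum, Finset.sum_comm]
        congr 1
        refine Finset.sum_congr rfl fun i _ => ?_
        rw [Finset.sum_comm]
        refine Finset.sum_congr rfl fun j _ => ?_
        simp only [mul_assoc]
        rw [← Finset.mul_sum, hcoord, hdir]
end

section
/- Let L = {B n : n ∈ ℤ³} be a Bravais lattice in ℝ³ with B an invertible real 3×3 matrix and unit-cell volume Ω₀ = |det B|, and let φ₀ : ℝ³ → ℝ be a continuously differentiable kernel (compactly supported, φ₀(−x) = φ₀(x)) satisfying the gradient moment condition −Σ_{y∈L} ∇φ₀(y) yᵀ = (1/Ω₀) I₃. For ε > 0 and w : ℝ³ → ℝ define the sampled gradient D̃_ε w(x) = −Ω₀ ε^{−1} Σ_{y∈L} ∇φ₀(y) w(x + εy) ∈ ℝ³. Then there exists a constant C, depending only on φ₀ and B, such that for every three times continuously differentiable w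 : ℝ³ → ℝ whose third-order partial derivatives are all bounded in absolute value by M, every ε ∈ (0,1], and every x ∈ ℝ³, one has ‖D̃_ε w(x) − ∇w(x)‖ ≤ C M ε². -/
open scoped BigOperators

/-- The Bravais lattice generated by an (invertible) matrix `B`. -/
def bravaisLattice (B : Matrix (Fin 3) (Fin 3) ℝ) : Set (Fin 3 → ℝ) :=
  {x | ∃ n : Fin 3 → ℤ, x = B.mulVec (fun k => (n k : ℝ))}

/-- Second-order Taylor expansion of a `C³` function of one variable about `0`, on either side. -/
lemma abs_sub_taylor_two_le {h : ℝ → ℝ} (hh : ContDiff ℝ 3 h) {K : ℝ}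
    (hK : ∀ t, |iteratedDeriv 3 h t| ≤ K) {t : ℝ} (ht : t ≠ 0) :
    |h t - (h 0 + t * deriv h 0 + t ^ 2 / 2 * iteratedDeriv 2 h 0)| ≤ K * |t| ^ 3 / 6 := by
  obtain ⟨s, -, hs⟩ := taylor_mean_remainder_lagrange_iteratedDeriv (n := 2) ht.symm
    (f := h) (by norm_num; exact hh.contDiffOn)
  have hu : UniqueDiffOn ℝ (Set.uIcc 0 t) := uniqueDiffOn_uIcc ht.symm
  have h1 : iteratedDerivWithin 1 h (Set.uIcc 0 t) 0 = deriv h 0 := by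
    rw [iteratedDerivWithin_eq_iteratedDeriv hu (hh.contDiffAt.of_le (by norm_num))
      Set.left_mem_uIcc, iteratedDeriv_one]
  have h2 : iteratedDerivWithin 2 h (Set.uIcc 0 t) 0 = iteratedDeriv 2 h 0 :=
    iteratedDerivWithin_eq_iteratedDeriv hu (hh.contDiffAt.of_le (by norm_num))
      Set.left_mem_uIcc
  have h3 : h t - (h 0 + t * deriv h 0 + t ^ 2 / 2 * iteratedDeriv 2 h 0)
      = iteratedDeriv 3 h s * t ^ 3 / 6 := by
    have e : h t - taylorWithinEval h 2 (Set.uIcc 0 t) 0 t = _ := hs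
    rw [taylorWithinEval_succ, taylorWithinEval_succ, taylor_within_zero_eval, h1, h2] at e
    norm_num [Nat.factorial] at e
    rw [← e]
    ring
  rw [h3, abs_div, abs_mul, abs_pow, abs_of_pos (by norm_num : (0 : ℝ) < 6)]
  gcongr
  exact hK s

/-- The central difference of a `C³` function approximates its derivative to second order. -/
lemma abs_central_difference_sub_le {h : ℝ → ℝ} (hh : ContDiff ℝ 3 h) {K : ℝ}
    (hK : ∀ t, |iteratedDeriv 3 h t| ≤ K) {t : ℝ} (ht : 0 < t) :
    |h t - h (-t) - 2 * t * deriv h 0| ≤ K * t ^ 3 / 3 := by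
  have h1 := abs_sub_taylor_two_le hh hK ht.ne'
  have h2 := abs_sub_taylor_two_le hh hK (neg_ne_zero.mpr ht.ne')
  rw [abs_neg] at h2
  rw [abs_of_pos ht, abs_le] at h1 h2
  rw [abs_le]
  constructor <;> nlinarith [h1.1, h1.2, h2.1, h2.2]

/-- Iterated derivatives of a function along an affine line. -/
lemma iteratedDeriv_comp_line {E : Type*} [NormedAddCommGroup E] [NormedSpace ℝ E]
    {w : E → ℝ} {n : ℕ} (hw : ContDiff ℝ n w) (x y : E) (t : ℝ) :
    iteratedDeriv n (fun s : ℝ => w (x + s • y)) t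
      = iteratedFDeriv ℝ n w (x + t • y) (fun _ => y) := by
  have hc : ContDiff ℝ n (fun z => w (x + z)) := by fun_prop
  have := (ContinuousLinearMap.toSpanSingleton ℝ y).iteratedFDeriv_comp_right hc t le_rfl
  rw [iteratedDeriv_eq_iteratedFDeriv]
  have e : (fun s : ℝ => w (x + s • y))
      = (fun z => w (x + z)) ∘ (ContinuousLinearMap.toSpanSingleton ℝ y) := by
    ext s; simp
  rw [e, this, iteratedFDeriv_comp_add_left]
  simp

/-- A multilinear map with bounded coefficients is bounded on the diagonal. -/
lemma abs_apply_diagonal_le {ι : Type*} [Fintype ι] [DecidableEq ι] {n : ℕ}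
    (f : ContinuousMultilinearMap ℝ (fun _ : Fin n => ι → ℝ) ℝ) {M : ℝ}
    (hf : ∀ idx : Fin n → ι, |f (fun k => Pi.single (idx k) 1)| ≤ M) (y : ι → ℝ) :
    |f (fun _ => y)| ≤ (Fintype.card ι : ℝ) ^ n * (M * ‖y‖ ^ n) := by
  have hy : y = ∑ i, y i • (Pi.single i 1 : ι → ℝ) := pi_eq_sum_univ' y
  have e : f (fun _ => y) = ∑ r : Fin n → ι,
      (∏ k, y (r k)) * f (fun k => Pi.single (r k) 1) := by
    conv_lhs => rw [hy]
    rw [f.map_sum]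
    refine Finset.sum_congr rfl fun r _ => ?_
    rw [f.map_smul_univ, smul_eq_mul]
  rw [e]
  refine (Finset.abs_sum_le_sum_abs _ _).trans ?_
  have : ∀ r ∈ (Finset.univ : Finset (Fin n → ι)),
      |(∏ k, y (r k)) * f (fun k => Pi.single (r k) 1)| ≤ M * ‖y‖ ^ n := by
    intro r _
    rw [abs_mul, mul_comm]
    have hp : |∏ k, y (r k)| ≤ ‖y‖ ^ n := by
      rw [Finset.abs_prod]
      calc ∏ k, |y (r k)| ≤ ∏ _k : Fin n, ‖y‖ :=
            Finset.prod_le_prod (fun _ _ => abs_nonneg _) fun k _ => norm_le_pi_norm y (r k)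
        _ = ‖y‖ ^ n := by simp
    exact mul_le_mul (hf r) hp (abs_nonneg _) ((abs_nonneg _).trans (hf r))
  refine (Finset.sum_le_card_nsmul _ _ _ this).trans_eq ?_
  simp

/-- A Bravais lattice meets every compact set in finitely many points. -/
lemma bravaisLattice_inter_finite {B : Matrix (Fin 3) (Fin 3) ℝ} (hB : IsUnit B.det)
    {K : Set (Fin 3 → ℝ)} (hK : IsCompact K) : (bravaisLattice B ∩ K).Finite := by
  have hcont : Continuous (fun y : Fin 3 → ℝ => B⁻¹.mulVec y) := by fun_prop
  have hfin : ((fun (n : Fin 3 → ℤ) (k : Fin 3) => (n k : ℝ)) ⁻¹'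
      ((fun y => B⁻¹.mulVec y) '' K)).Finite := by
    obtain ⟨R, hR⟩ := (hK.image hcont).isBounded.exists_norm_le
    refine (Set.finite_Icc (fun _ : Fin 3 => -⌈R⌉) (fun _ => ⌈R⌉)).subset fun n hn => ?_
    have hle : ∀ k, |(n k : ℝ)| ≤ R := fun k =>
      (norm_le_pi_norm (fun k => (n k : ℝ)) k).trans (hR _ hn)
    refine ⟨fun k => ?_, fun k => ?_⟩
    · have := (abs_le.mp (hle k)).1
      have h2 := Int.le_ceil R
      have : (-(⌈R⌉ : ℝ)) ≤ n k := by linarith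
      exact_mod_cast this
    · have := (abs_le.mp (hle k)).2.trans (Int.le_ceil R)
      exact_mod_cast this
  refine (hfin.image fun n => B.mulVec (fun k => (n k : ℝ))).subset ?_
  rintro y ⟨⟨n, rfl⟩, hy⟩
  refine ⟨n, ⟨_, hy, ?_⟩, rfl⟩
  simp [Matrix.mulVec_mulVec, Matrix.nonsing_inv_mul B hB]

lemma neg_mem_bravaisLattice {B : Matrix (Fin 3) (Fin 3) ℝ} {y : Fin 3 → ℝ}
    (hy : y ∈ bravaisLattice B) : -y ∈ bravaisLattice B := by
  obtain ⟨n, rfl⟩ := hy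
  refine ⟨-n, ?_⟩
  rw [← Matrix.mulVec_neg]
  congr 1
  ext k
  simp

/-- The derivative of a differentiable even function is odd. -/
lemma fderiv_neg_of_even {E : Type*} [NormedAddCommGroup E] [NormedSpace ℝ E] {f : E → ℝ}
    (hd : Differentiable ℝ f) (hf : ∀ x, f (-x) = f x) (x : E) :
    fderiv ℝ f (-x) = -fderiv ℝ f x := by
  have h : HasFDerivAt f ((fderiv ℝ f (-x)).comp (-ContinuousLinearMap.id ℝ E)) x := by
    have := (hd (-x)).hasFDerivAt.comp x (hasFDerivAt_id x).neg
    exact this.congr_of_eventuallyEq (Filter.Eventually.of_forall fun z => (hf z).symm)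
  rw [h.fderiv]
  ext v
  simp

/-- Central differences of a `C³` function along `y` are second-order accurate. -/
lemma abs_directional_central_difference_sub_le {ι : Type*} [Fintype ι] [DecidableEq ι]
    {w : (ι → ℝ) → ℝ} {M : ℝ} (hw : ContDiff ℝ 3 w)
    (hM : ∀ (x : ι → ℝ) (idx : Fin 3 → ι),
      |iteratedFDeriv ℝ 3 w x (fun k => Pi.single (idx k) 1)| ≤ M)
    {ε : ℝ} (hε : 0 < ε) (x y : ι → ℝ) :
    |w (x + ε • y) - w (x + ε • -y) - 2 * ε * fderiv ℝ w x y|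
      ≤ (Fintype.card ι : ℝ) ^ 3 * (M * ‖y‖ ^ 3) * ε ^ 3 / 3 := by
  have hh : ContDiff ℝ 3 (fun t : ℝ => w (x + t • y)) := by fun_prop
  have hd : deriv (fun t : ℝ => w (x + t • y)) 0 = fderiv ℝ w x y := by
    have hx : HasFDerivAt w (fderiv ℝ w x) x :=
      (hw.differentiable (by norm_num) x).hasFDerivAt
    exact (hx.hasLineDerivAt y).deriv
  have := abs_central_difference_sub_le hh (K := (Fintype.card ι : ℝ) ^ 3 * (M * ‖y‖ ^ 3))
    (fun t => by
      rw [iteratedDeriv_comp_line (n := 3) (mod_cast hw) x y t]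
      exact abs_apply_diagonal_le _ (hM _) y) hε
  simpa [hd] using this

/-- Let `L` be a Bravais lattice with unit-cell volume `Ω₀ = |det B|` and
`φ₀` a compactly supported even `C¹` kernel satisfying the gradient moment condition
`−Σ_{y∈L} ∇φ₀(y) yᵀ = (1/Ω₀) I₃`. Then there is a constant `C` (depending only on `φ₀`
and `B`) such that for every `C³` function `w` with third partial derivatives bounded by
`M`, every `ε ∈ (0,1]`, and every `x`, the sampled gradient
`D̃_ε w(x) = −Ω₀ ε⁻¹ Σ_{y∈L} ∇φ₀(y) w(x + εy)` satisfies
`‖D̃_ε w(x) − ∇w(x)‖ ≤ C M ε²`. -/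
theorem sampled_gradient_second_order_accuracy
    (B : Matrix (Fin 3) (Fin 3) ℝ) (hB : IsUnit B.det)
    (φ₀ : (Fin 3 → ℝ) → ℝ) (hφ : ContDiff ℝ 1 φ₀) (hc : HasCompactSupport φ₀)
    (hsymm : ∀ x : Fin 3 → ℝ, φ₀ (-x) = φ₀ x)
    (hμ1 : ∀ α β : Fin 3,
      (- ∑ᶠ y ∈ bravaisLattice B, fderiv ℝ φ₀ y (Pi.single α 1) * y β)
        = (1 / |B.det|) * (if α = β then 1 else 0)) :
    ∃ C : ℝ, ∀ (w : (Fin 3 → ℝ) → ℝ) (M : ℝ), ContDiff ℝ 3 w →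
      (∀ (x : Fin 3 → ℝ) (idx : Fin 3 → Fin 3),
        |iteratedFDeriv ℝ 3 w x (fun k => Pi.single (idx k) 1)| ≤ M) →
      ∀ ε : ℝ, ε ∈ Set.Ioc (0:ℝ) 1 → ∀ x : Fin 3 → ℝ,
        ‖(fun α : Fin 3 => -(|B.det| * ε⁻¹) *
              (∑ᶠ y ∈ bravaisLattice B,
                fderiv ℝ φ₀ y (Pi.single α 1) * w (x + ε • y)))
          - (fun α : Fin 3 => fderiv ℝ w x (Pi.single α 1))‖
          ≤ C * M * ε ^ 2 := by
  obtain ⟨F, hF⟩ := (bravaisLattice_inter_finite hB hc).exists_finset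
  have hneg : ∀ y ∈ F, -y ∈ F := by
    intro y hy
    rw [hF] at hy ⊢
    refine ⟨neg_mem_bravaisLattice hy.1, ?_⟩
    have : φ₀ ∘ Homeomorph.neg _ = φ₀ := funext hsymm
    rw [← this, tsupport_comp_eq_preimage]
    simpa using hy.2
  have hsum : ∀ (α : Fin 3) (u : (Fin 3 → ℝ) → ℝ),
      ∑ᶠ y ∈ bravaisLattice B, fderiv ℝ φ₀ y (Pi.single α 1) * u y
        = ∑ y ∈ F, fderiv ℝ φ₀ y (Pi.single α 1) * u y := by
    intro α u
    refine finsum_mem_eq_sum_of_inter_support_eq _ ?_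
    ext y
    simp only [Set.mem_inter_iff, Finset.mem_coe, hF, Function.mem_support]
    refine ⟨fun ⟨h1, h2⟩ => ⟨⟨h1, ?_⟩, h2⟩, fun ⟨h1, h2⟩ => ⟨h1.1, h2⟩⟩
    refine support_fderiv_subset ℝ ?_
    intro h0
    simp [h0] at h2
  refine ⟨9 / 2 * |B.det| * ∑ y ∈ F, ‖fderiv ℝ φ₀ y‖ * ‖y‖ ^ 3, ?_⟩
  rintro w M hw hM ε ⟨hε, -⟩ x
  have hM0 : 0 ≤ M := (abs_nonneg _).trans (hM 0 0)
  have hΩ : |B.det| ≠ 0 := abs_ne_zero.mpr hB.ne_zero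
  refine (pi_norm_le_iff_of_nonneg (by positivity)).mpr fun α => ?_
  simp only [Pi.sub_apply, hsum, Real.norm_eq_abs]
  set g : (Fin 3 → ℝ) → ℝ := fun y => fderiv ℝ φ₀ y (Pi.single α 1) with hg
  have hsymmetrize : ∑ y ∈ F, g y * w (x + ε • y)
      = 1 / 2 * ∑ y ∈ F, g y * (w (x + ε • y) - w (x + ε • -y)) := by
    have h1 : ∑ y ∈ F, g y * w (x + ε • -y) = -∑ y ∈ F, g y * w (x + ε • y) := by
      rw [← Finset.sum_neg_distrib]
      refine Finset.sum_nbij' (fun y => -y) (fun y => -y) hneg hneg (by simp) (by simp) ?_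
      intro y _
      simp [hg, fderiv_neg_of_even (hφ.differentiable one_ne_zero) hsymm]
    simp only [mul_sub, Finset.sum_sub_distrib, h1]
    ring
  have hmoment : ∑ y ∈ F, g y * fderiv ℝ w x y
      = -(1 / |B.det|) * fderiv ℝ w x (Pi.single α 1) := by
    have h1 : ∀ β, ∑ y ∈ F, g y * y β = -((1 / |B.det|) * (if α = β then 1 else 0)) := by
      intro β
      rw [← hμ1 α β, hsum α (fun y => y β), neg_neg]
    have h2 : ∀ y : Fin 3 → ℝ, fderiv ℝ w x y
        = ∑ β, y β * fderiv ℝ w x (Pi.single β 1) := by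
      intro y
      conv_lhs => rw [pi_eq_sum_univ' y]
      simp only [map_sum, map_smul, smul_eq_mul]
    calc ∑ y ∈ F, g y * fderiv ℝ w x y
        = ∑ β, (∑ y ∈ F, g y * y β) * fderiv ℝ w x (Pi.single β 1) := by
          simp only [Finset.sum_mul]
          rw [Finset.sum_comm]
          refine Finset.sum_congr rfl fun y _ => ?_
          rw [h2 y, Finset.mul_sum]
          exact Finset.sum_congr rfl fun β _ => by ring
      _ = _ := by simp [h1]
  have herr : -(|B.det| * ε⁻¹) * (∑ y ∈ F, g y * w (x + ε • y))
      - fderiv ℝ w x (Pi.single α 1)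
      = -(|B.det| * ε⁻¹ / 2) * ∑ y ∈ F,
        g y * (w (x + ε • y) - w (x + ε • -y) - 2 * ε * fderiv ℝ w x y) := by
    have h1 : ∑ y ∈ F, g y * (w (x + ε • y) - w (x + ε • -y) - 2 * ε * fderiv ℝ w x y)
        = ∑ y ∈ F, g y * (w (x + ε • y) - w (x + ε • -y))
          - 2 * ε * ∑ y ∈ F, g y * fderiv ℝ w x y := by
      rw [Finset.mul_sum, ← Finset.sum_sub_distrib]
      exact Finset.sum_congr rfl fun y _ => by ring
    rw [h1, hmoment, hsymmetrize]
    field_simp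
    ring
  have hgle : ∀ y, |g y| ≤ ‖fderiv ℝ φ₀ y‖ := fun y => by
    have h1 : ‖(Pi.single α 1 : Fin 3 → ℝ)‖ ≤ 1 := by
      rw [Pi.norm_single, norm_one]
    have h2 := (fderiv ℝ φ₀ y).le_opNorm_of_le h1
    rwa [mul_one] at h2
  rw [herr, abs_mul, abs_neg, abs_of_nonneg (by positivity : 0 ≤ |B.det| * ε⁻¹ / 2)]
  calc |B.det| * ε⁻¹ / 2 * |∑ y ∈ F,
        g y * (w (x + ε • y) - w (x + ε • -y) - 2 * ε * fderiv ℝ w x y)|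
      ≤ |B.det| * ε⁻¹ / 2 * ∑ y ∈ F, ‖fderiv ℝ φ₀ y‖ * (9 * (M * ‖y‖ ^ 3) * ε ^ 3) := by
        gcongr
        refine (Finset.abs_sum_le_sum_abs _ _).trans (Finset.sum_le_sum fun y _ => ?_)
        rw [abs_mul]
        refine mul_le_mul (hgle y) ?_ (abs_nonneg _) (norm_nonneg _)
        refine (abs_directional_central_difference_sub_le hw hM hε x y).trans_eq ?_
        simp only [Fintype.card_fin]
        push_cast
        ring
    _ = 9 / 2 * |B.det| * (∑ y ∈ F, ‖fderiv ℝ φ₀ y‖ * ‖y‖ ^ 3) * M * ε ^ 2 := by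
        have : ∀ y, ‖fderiv ℝ φ₀ y‖ * (9 * (M * ‖y‖ ^ 3) * ε ^ 3)
            = 9 * M * ε ^ 3 * (‖fderiv ℝ φ₀ y‖ * ‖y‖ ^ 3) := fun y => by ring
        simp only [this, ← Finset.mul_sum]
        field_simp
end
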